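/- Fix a vertex a ≠ 0 and write a_i := p^i(a) for the i-th iterated parent of a (so a_0 = a and a_{d(a)} = 0). For all 0 ≤ j < n ≤ d(a), the mean hitting time of a_n starting from a_j is E[T^{a_j}_{a_n}] = Σ_{k=j}^{n−1} π(B_{a_k}) / (μ_{a_k}·π(a_k)). -/

import Mathlib

open MeasureTheory ProbabilityTheory Filter Topology ENNReal

noncomputable section

/-- A discrete-time birth-and-death chain on a countable rooted tree `I`.
The tree is encoded by a root, a parent map and a depth function; the chain is
encoded by its transition matrix `P` (nonzero only between tree-neighbours and
on the diagonal) and by the laws `law x` of the trajectories started at `x`,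
characterised by the cylinder formula.  `invm` is the reversible invariant
probability measure of the chain (positive recurrence). -/
structure TreeChain (I : Type*) [MeasurableSpace I] where
  root : I
  par : I → I
  depth : I → ℕ
  par_root : par root = root
  depth_root : depth root = 0
  depth_eq_zero : ∀ x, depth x = 0 → x = root
  depth_par : ∀ x, x ≠ root → depth x = depth (par x) + 1
  P : I → I → ℝ≥0∞
  P_row : ∀ x, ∑' y, P x y = 1
  P_support : ∀ x y, P x y ≠ 0 → y = x ∨ y = par x ∨ x = par y
  lam_pos : ∀ x, x ≠ root → P (par x) x ≠ 0
  mu_pos : ∀ x, x ≠ root → P x (par x) ≠ 0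
  law : I → Measure (ℕ → I)
  law_prob : ∀ x, IsProbabilityMeasure (law x)
  law_start : ∀ x, law x {ω | ω 0 = x} = 1
  law_cyl : ∀ x (n : ℕ) (γ : ℕ → I), γ 0 = x →
    law x {ω | ∀ i ≤ n, ω i = γ i} = ∏ i ∈ Finset.range n, P (γ i) (γ (i + 1))
  invm : I → ℝ≥0∞
  invm_pos : ∀ x, invm x ≠ 0
  invm_sum : ∑' x, invm x = 1
  invm_rev : ∀ x y, invm x * P x y = invm y * P y x

/-- The hitting time of `y`, as an extended nonnegative real (`∞` if `y` is never hit). -/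
def hitTime {I : Type*} (y : I) (ω : ℕ → I) : ℝ≥0∞ :=
  ⨅ (t : ℕ) (_ : ω t = y), (t : ℝ≥0∞)

namespace TreeChain

variable {I : Type*} [MeasurableSpace I] (c : TreeChain I)

/-- The branch `B_x` stemming from `x`: the set of descendants of `x` (including `x`). -/
def branch (x : I) : Set I := {y | ∃ n, c.par^[n] y = x}

/-- The set `ℓ(x)` of vertices on the path from `x` to the root, the root excluded. -/
def pathToRoot (x : I) : Set I := {y | ∃ i < c.depth x, c.par^[i] x = y}

/-- The set `σ(x)` of children of `x`. -/
def children (x : I) : Set I := {y | y ≠ c.root ∧ c.par y = x}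

/-- `μ_x`, the transition probability from `x` to its parent. -/
def mu (x : I) : ℝ≥0∞ := c.P x (c.par x)

/-- `λ_x`, the transition probability from the parent of `x` to `x`. -/
def lamP (x : I) : ℝ≥0∞ := c.P (c.par x) x

/-- `π(A)`, the invariant mass of a set of vertices. -/
def piSet (A : Set I) : ℝ≥0∞ := ∑' y : A, c.invm (y : I)

/-- `E[T^x_y]`, the expected hitting time of `y` for the chain started at `x`. -/
def ET (x y : I) : ℝ≥0∞ := ∫⁻ ω, hitTime y ω ∂(c.law x)

/-- `E[(T^x_y)²]`, the second moment of the hitting time of `y` started at `x`. -/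
def ET2 (x y : I) : ℝ≥0∞ := ∫⁻ ω, (hitTime y ω) ^ 2 ∂(c.law x)

/-- The normalised hitting time `T^x_y / E[T^x_y]` as a real random variable. -/
def ratio (x y : I) (ω : ℕ → I) : ℝ := (hitTime y ω).toReal / (c.ET x y).toReal

/-- `α(a)`: the child of the root lying on the path from `a` to the root. -/
def alphaVert (a : I) : I := c.par^[c.depth a - 1] a

/-- The drift constant `K_a = sup_{b ∈ B_{α(a)}} μ_b · E[T^b_{p(b)}]`. -/
def Kdrift (a : I) : ℝ≥0∞ :=
  ⨆ b ∈ c.branch (c.alphaVert a), c.mu b * c.ET b (c.par b)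

/-- The global constant `K'_a = sup_{b ∈ I} μ_b · E[T^b_{p(b)}]`. -/
def Kdrift' : ℝ≥0∞ := ⨆ b : I, c.mu b * c.ET b (c.par b)

/-- The quantity `Q_x = π(B_x)⁻¹ · Σ_{b ∈ B_x} π(B_b)²/(μ_b π(b))`. -/
def Qx (x : I) : ℝ≥0∞ :=
  (c.piSet (c.branch x))⁻¹ *
    ∑' b : c.branch x, (c.piSet (c.branch (b : I))) ^ 2 / (c.mu (b : I) * c.invm (b : I))

/-- `Q_a = sup_{x ∈ ℓ(a)} Q_x`. -/
def Qsup (a : I) : ℝ≥0∞ := ⨆ x ∈ c.pathToRoot a, c.Qx x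

/-- `R_a = Σ_{b ∈ ℓ(a)} π(B_b)²/(μ_b π(b))`. -/
def Rsum (a : I) : ℝ≥0∞ :=
  ∑' b : c.pathToRoot a, (c.piSet (c.branch (b : I))) ^ 2 / (c.mu (b : I) * c.invm (b : I))

/-- The set `C_{a,k}`: union over the vertices `a_l`, `k < l ≤ d(a)`, of the path from
`a_k` to the root, of the branches stemming from the children of `a_l` other
than `a_{l-1}`. -/
def Cset (a : I) (k : ℕ) : Set I :=
  {y | ∃ l, k + 1 ≤ l ∧ l ≤ c.depth a ∧
    ∃ ch, ch ∈ c.children (c.par^[l] a) ∧ ch ≠ c.par^[l - 1] a ∧ y ∈ c.branch ch}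

end TreeChain

/-- The strong drift condition `0^ℓ-SD` toward the root, for a family of chains
`c n` with distinguished vertices `a n` (the limit `a → ∞` being `n → ∞`). -/
def StrongDrift {I : ℕ → Type*} [∀ n, MeasurableSpace (I n)]
    (c : ∀ n, TreeChain (I n)) (a : ∀ n, I n) : Prop :=
  (∃ Kmu : ℝ≥0∞, 0 < Kmu ∧
      ∀ n, ∀ b ∈ (c n).branch ((c n).alphaVert (a n)), Kmu ≤ (c n).mu b) ∧
  Tendsto (fun n => ((c n).Kdrift (a n)) ^ 2 / (c n).ET (a n) (c n).root) atTop (𝓝 0)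

/-- Dominated convergence for sums of extended nonnegative reals. -/
theorem ENNReal.tendsto_tsum_mul_zero {ι : Type*} {p : ι → ℝ≥0∞} {v : ℕ → ι → ℝ≥0∞}
    (hp : ∑' i, p i ≠ ∞) (hv : ∀ t i, v t i ≤ 1)
    (hlim : ∀ i, p i ≠ 0 → Tendsto (fun t => v t i) atTop (𝓝 0)) :
    Tendsto (fun t => ∑' i, p i * v t i) atTop (𝓝 0) := by
  let _ : MeasurableSpace ι := ⊤
  have hlim' : ∀ i, Tendsto (fun t => p i * v t i) atTop (𝓝 0) := fun i => by
    by_cases hi : p i = 0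
    · simp [hi]
    · simpa using ENNReal.Tendsto.const_mul (hlim i hi)
        (Or.inr (ENNReal.ne_top_of_tsum_ne_top hp i))
  have h := tendsto_lintegral_of_dominated_convergence (μ := Measure.count)
    (F := fun t i => p i * v t i) (f := fun _ => 0) p (fun t => measurable_from_top)
    (fun t => Eventually.of_forall fun i => mul_le_of_le_one_right' (hv t i))
    (by rwa [lintegral_count]) (Eventually.of_forall hlim')
  simpa [lintegral_count] using h

theorem hitTime_eq_tsum {I : Type*} (y : I) (ω : ℕ → I) :
    hitTime y ω = ∑' t : ℕ, {ω : ℕ → I | ∀ i ≤ t, ω i ≠ y}.indicator 1 ω := by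
  classical
  by_cases h : ∃ t, ω t = y
  · have hτ : hitTime y ω = (Nat.find h : ℝ≥0∞) :=
      le_antisymm (iInf₂_le (f := fun (t : ℕ) (_ : ω t = y) => (t : ℝ≥0∞)) _ (Nat.find_spec h))
        (le_iInf₂ fun t ht => by exact_mod_cast Nat.find_min' h ht)
    rw [hτ, tsum_eq_sum (s := Finset.range (Nat.find h))]
    · rw [Finset.sum_congr rfl (g := fun _ => (1 : ℝ≥0∞))]
      · simp
      · intro t ht
        have hmem : ω ∈ {ω : ℕ → I | ∀ i ≤ t, ω i ≠ y} := fun i hi =>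
          Nat.find_min h (hi.trans_lt (Finset.mem_range.1 ht))
        exact Set.indicator_of_mem hmem _
    · intro t ht
      refine Set.indicator_of_notMem (fun hω => ?_) _
      exact hω _ (not_lt.1 fun h' => ht (Finset.mem_range.2 h')) (Nat.find_spec h)
  · push Not at h
    simp [hitTime, h]

theorem measurableSet_forall_le_mem {I : Type*} [MeasurableSpace I] [DiscreteMeasurableSpace I]
    (t : ℕ) (f : ℕ → ℕ) (s : ℕ → Set I) : MeasurableSet {ω : ℕ → I | ∀ i ≤ t, ω (f i) ∈ s i} := by
  have h : {ω : ℕ → I | ∀ i ≤ t, ω (f i) ∈ s i}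
      = ⋂ i, ⋂ (_ : i ≤ t), (fun ω => ω (f i)) ⁻¹' s i := by
    ext ω
    simp
  rw [h]
  exact MeasurableSet.iInter fun i => MeasurableSet.iInter fun _ =>
    measurable_pi_apply (f i) MeasurableSet.of_discrete

namespace TreeChain

section Measurability

variable {I : Type*} [MeasurableSpace I] [Countable I] (c : TreeChain I)

open Classical in
theorem law_le_tsum (x y : I) :
    c.law x {ω | ω 0 = x ∧ ω 1 ≠ y} ≤ ∑' z, if z = y then 0 else c.P x z := by
  have hsub : {ω : ℕ → I | ω 0 = x ∧ ω 1 ≠ y} ⊆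
      ⋃ z, {ω | ω 0 = x ∧ ω 1 = z ∧ z ≠ y} := fun ω hω =>
    Set.mem_iUnion.2 ⟨ω 1, hω.1, rfl, hω.2⟩
  refine (measure_mono hsub).trans ((measure_iUnion_le _).trans (ENNReal.tsum_le_tsum fun z => ?_))
  split_ifs with hz
  · simp [hz]
  · have h := c.law_cyl x 1 (fun i => if i = 0 then x else z) rfl
    simp only [Finset.prod_range_one] at h
    refine (measure_mono fun ω hω i hi => ?_).trans h.le
    interval_cases i
    · exact hω.1
    · exact hω.2.1

theorem exists_measurableSet_separating {y y' : I} (hy : y ≠ c.root) (hne : y' ≠ y) :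
    ∃ s, MeasurableSet s ∧ y ∈ s ∧ y' ∉ s := by
  classical
  by_contra! hsep
  set x := c.par y
  have := c.law_prob x
  have hmem : {ω : ℕ → I | ω 0 = x} ⊆ toMeasurable (c.law x) {ω | ω 0 = x ∧ ω 1 ≠ y} := by
    intro ω hω
    by_cases h1 : ω 1 = y
    · have hM := measurable_update ω (a := 1)
        (measurableSet_toMeasurable (c.law x) {ω | ω 0 = x ∧ ω 1 ≠ y})
      by_contra hn
      refine hsep _ hM.compl ?_ ?_
      · rw [Set.mem_compl_iff, Set.mem_preimage]
        have hupd : Function.update ω 1 y = ω := by rw [← h1, Function.update_eq_self]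
        rwa [hupd]
      · refine subset_toMeasurable _ _ ⟨?_, ?_⟩
        · simpa using hω
        · simpa using hne
    · exact subset_toMeasurable _ _ ⟨hω, h1⟩
  have h1 : 1 ≤ ∑' z, if z = y then 0 else c.P x z := by
    rw [← c.law_start x]
    exact (measure_mono hmem).trans ((measure_toMeasurable _).trans_le (c.law_le_tsum x y))
  have h2 : c.P x y + ∑' z, (if z = y then 0 else c.P x z) = 1 := by
    rw [← c.P_row x, ENNReal.tsum_eq_add_tsum_ite (f := c.P x) y]
  have h3 : c.P x y + 1 ≤ 0 + 1 := by
    rw [zero_add]; exact (add_le_add_right h1 _).trans h2.le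
  exact c.lam_pos y hy (le_zero_iff.1 ((ENNReal.add_le_add_iff_right ENNReal.one_ne_top).1 h3))

/-- The cylinder formula forces the `σ`-algebra of the state space to be discrete. -/
theorem discreteMeasurableSpace {I : Type*} [MeasurableSpace I] [Countable I]
    (c : TreeChain I) : DiscreteMeasurableSpace I := by
  have key : ∀ y, y ≠ c.root → MeasurableSet {y} := fun y hy => by
    have h : ∀ y', ∃ s, MeasurableSet s ∧ y ∈ s ∧ (y' ≠ y → y' ∉ s) := fun y' => by
      by_cases hne : y' = y
      · exact ⟨Set.univ, MeasurableSet.univ, trivial, fun h => absurd hne h⟩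
      · obtain ⟨s, hs, h1, h2⟩ := c.exists_measurableSet_separating hy hne
        exact ⟨s, hs, h1, fun _ => h2⟩
    choose s hs hys hs' using h
    convert MeasurableSet.iInter hs
    ext z
    simp only [Set.mem_singleton_iff, Set.mem_iInter]
    exact ⟨fun h i => h ▸ hys i, fun h => by_contra fun hz => hs' z hz (h z)⟩
  have hroot : MeasurableSet {c.root} := by
    have h : MeasurableSet (⋃ y : {y // y ≠ c.root}, {(y : I)}) :=
      MeasurableSet.iUnion fun y => key y y.2
    convert h.compl
    ext z
    simp
  have : MeasurableSingletonClass I := ⟨fun y => by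
    by_cases hy : y = c.root
    · exact hy ▸ hroot
    · exact key y hy⟩
  infer_instance

end Measurability

section Survival

variable {I : Type*} [MeasurableSpace I] (c : TreeChain I)

open Classical in
/-- The probability that the chain started at `z` avoids `y` up to time `t`. -/
def survival (y : I) : ℕ → I → ℝ≥0∞
  | 0, z => if z = y then 0 else 1
  | t + 1, z => if z = y then 0 else ∑' w, c.P z w * survival y t w

theorem survival_self (y : I) (t : ℕ) : c.survival y t y = 0 := by
  cases t <;> simp [survival]

theorem survival_succ {y z : I} (h : z ≠ y) (t : ℕ) :
    c.survival y (t + 1) z = ∑' w, c.P z w * c.survival y t w := by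
  simp [survival, h]

theorem survival_le_one (y : I) (t : ℕ) (z : I) : c.survival y t z ≤ 1 := by
  induction t generalizing z with
  | zero => simp only [survival]; split_ifs <;> simp
  | succ t ih =>
    simp only [survival]
    split_ifs
    · simp
    · exact (ENNReal.tsum_le_tsum fun w => mul_le_of_le_one_right' (ih w)).trans (c.P_row z).le

theorem law_cylinder_inter_avoid [Countable I] (y : I) (t n : ℕ) (γ : ℕ → I) :
    c.law (γ 0) {ω | (∀ i ≤ n, ω i = γ i) ∧ ∀ i ≤ t, ω (n + i) ≠ y}
      = (∏ i ∈ Finset.range n, c.P (γ i) (γ (i + 1))) * c.survival y t (γ n) := by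
  classical
  have := c.discreteMeasurableSpace
  induction t generalizing n γ with
  | zero =>
    by_cases h : γ n = y
    · have : {ω : ℕ → I | (∀ i ≤ n, ω i = γ i) ∧ ∀ i ≤ 0, ω (n + i) ≠ y} = ∅ := by
        ext ω
        simp only [Set.mem_ofPred_eq, Set.mem_empty_iff_false, iff_false]
        exact fun hω => hω.2 0 le_rfl ((hω.1 n le_rfl).trans h)
      rw [this, measure_empty, h, survival_self, mul_zero]
    · have : {ω : ℕ → I | (∀ i ≤ n, ω i = γ i) ∧ ∀ i ≤ 0, ω (n + i) ≠ y}
          = {ω | ∀ i ≤ n, ω i = γ i} := by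
        ext ω
        simp only [Set.mem_ofPred_eq, and_iff_left_iff_imp]
        intro hω i hi
        rw [Nat.le_zero.1 hi, add_zero, hω n le_rfl]
        exact h
      rw [this, c.law_cyl _ n γ rfl]
      simp [survival, h]
  | succ t ih =>
    by_cases h : γ n = y
    · have : {ω : ℕ → I | (∀ i ≤ n, ω i = γ i) ∧ ∀ i ≤ t + 1, ω (n + i) ≠ y} = ∅ := by
        ext ω
        simp only [Set.mem_ofPred_eq, Set.mem_empty_iff_false, iff_false]
        exact fun hω => hω.2 0 (Nat.zero_le _) ((hω.1 n le_rfl).trans h)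
      simp [this, h, survival_self]
    set γ' : I → ℕ → I := fun w => Function.update γ (n + 1) w
    have hlt : ∀ w i, i ≤ n → γ' w i = γ i := fun w i hi =>
      Function.update_of_ne (by omega) _ _
    have hsucc : ∀ w, γ' w (n + 1) = w := fun w => Function.update_self _ _ _
    have hset : {ω : ℕ → I | (∀ i ≤ n, ω i = γ i) ∧ ∀ i ≤ t + 1, ω (n + i) ≠ y}
        = ⋃ w, {ω | (∀ i ≤ n + 1, ω i = γ' w i) ∧ ∀ i ≤ t, ω (n + 1 + i) ≠ y} := by
      ext ω
      simp only [Set.mem_ofPred_eq, Set.mem_iUnion]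
      constructor
      · rintro ⟨h1, h2⟩
        refine ⟨ω (n + 1), fun i hi => ?_, fun i hi => ?_⟩
        · rcases Nat.le_succ_iff.1 hi with hi | rfl
          · rw [hlt _ _ hi, h1 i hi]
          · rw [hsucc]
        · rw [add_assoc, add_comm 1 i]
          exact h2 _ (by omega)
      · rintro ⟨w, h1, h2⟩
        have h3 : ∀ i ≤ n, ω i = γ i := fun i hi => by rw [h1 i (by omega), hlt w i hi]
        refine ⟨h3, fun i hi => ?_⟩
        rcases i with _ | i
        · rw [add_zero, h3 n le_rfl]; exact h
        · rw [add_comm i 1, ← add_assoc]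
          exact h2 i (by omega)
    have hdisj : Pairwise (Function.onFun Disjoint fun w =>
        {ω : ℕ → I | (∀ i ≤ n + 1, ω i = γ' w i) ∧ ∀ i ≤ t, ω (n + 1 + i) ≠ y}) := by
      intro w w' hw
      refine Set.disjoint_left.2 fun ω h1 h2 => hw ?_
      rw [← hsucc w, ← hsucc w', ← h1.1 _ le_rfl, ← h2.1 _ le_rfl]
    have hmeas : ∀ w, MeasurableSet
        {ω : ℕ → I | (∀ i ≤ n + 1, ω i = γ' w i) ∧ ∀ i ≤ t, ω (n + 1 + i) ≠ y} := fun w => by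
      exact (measurableSet_forall_le_mem (n + 1) id fun i => {γ' w i}).inter
        (measurableSet_forall_le_mem t (n + 1 + ·) fun _ => {y}ᶜ)
    rw [hset, measure_iUnion hdisj hmeas, c.survival_succ h, ← ENNReal.tsum_mul_left]
    refine tsum_congr fun w => ?_
    have hw := ih (n + 1) (γ' w)
    rw [hlt w 0 (Nat.zero_le n)] at hw
    rw [hw, Finset.prod_range_succ, hsucc, hlt w n le_rfl, mul_assoc]
    congr 1
    refine Finset.prod_congr rfl fun i hi => ?_
    have := Finset.mem_range.1 hi
    rw [hlt w i (by omega), hlt w (i + 1) (by omega)]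

theorem ET_eq_tsum_survival [Countable I] (x y : I) :
    c.ET x y = ∑' t, c.survival y t x := by
  have := c.discreteMeasurableSpace
  have := c.law_prob x
  have hmeas : ∀ t : ℕ, MeasurableSet {ω : ℕ → I | ∀ i ≤ t, ω i ≠ y} := fun t =>
    measurableSet_forall_le_mem t id fun _ => {y}ᶜ
  have hstart : ∀ᵐ ω ∂(c.law x), ω 0 = x := by
    have h0 : MeasurableSet {ω : ℕ → I | ω 0 = x} :=
      measurable_pi_apply (X := fun _ : ℕ => I) 0 (MeasurableSet.of_discrete (s := {x}))
    exact (prob_compl_eq_zero_iff h0).2 (c.law_start x)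
  simp only [ET, hitTime_eq_tsum]
  rw [lintegral_tsum fun t => (measurable_one.indicator (hmeas t)).aemeasurable]
  refine tsum_congr fun t => ?_
  rw [lintegral_indicator_one (hmeas t)]
  have h := c.law_cylinder_inter_avoid y t 0 (fun _ => x)
  rw [Finset.range_zero, Finset.prod_empty, one_mul] at h
  rw [← h]
  refine measure_congr ?_
  filter_upwards [hstart] with ω hω
  refine propext ⟨fun h' => ⟨fun i hi => ?_, fun i hi => ?_⟩, fun h' i hi => ?_⟩
  · rw [Nat.le_zero.1 hi, hω]
  · rw [zero_add]; exact h' i hi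
  · have := h'.2 i hi
    rwa [zero_add] at this

end Survival

section Branch

variable {I : Type*} [MeasurableSpace I] (c : TreeChain I)

theorem mem_branch_iff {x z : I} : z ∈ c.branch x ↔ z = x ∨ c.par z ∈ c.branch x := by
  constructor
  · rintro ⟨_ | n, hn⟩
    · exact Or.inl hn
    · exact Or.inr ⟨n, hn⟩
  · rintro (h | ⟨n, hn⟩)
    · exact ⟨0, h⟩
    · exact ⟨n + 1, hn⟩

theorem depth_par_le (x : I) : c.depth (c.par x) ≤ c.depth x := by
  by_cases h : x = c.root
  · rw [h, c.par_root]
  · exact c.depth_par x h ▸ Nat.le_succ _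

theorem depth_par_lt {x : I} (hx : x ≠ c.root) : c.depth (c.par x) < c.depth x := by
  rw [c.depth_par x hx]; exact Nat.lt_succ_self _

theorem depth_le_of_mem_branch {x z : I} (h : z ∈ c.branch x) : c.depth x ≤ c.depth z := by
  obtain ⟨n, rfl⟩ := h
  induction n generalizing z with
  | zero => exact le_rfl
  | succ n ih => exact ih.trans (c.depth_par_le z)

theorem depth_iterate_par (a : I) {k : ℕ} (hk : k ≤ c.depth a) :
    c.depth (c.par^[k] a) + k = c.depth a := by
  induction k with
  | zero => rfl
  | succ k ih =>
    have h := ih (by omega)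
    have hne : c.par^[k] a ≠ c.root := fun h' => by
      rw [h', c.depth_root] at h; omega
    rw [Function.iterate_succ_apply']
    have := c.depth_par _ hne
    omega

theorem P_le_one (x y : I) : c.P x y ≤ 1 :=
  (ENNReal.le_tsum y).trans (c.P_row x).le

theorem piSet_le_one (s : Set I) : c.piSet s ≤ 1 :=
  (ENNReal.tsum_comp_le_tsum_of_injective Subtype.val_injective _).trans c.invm_sum.le

open Classical in
theorem branch_flux {x : I} (hx : x ≠ c.root) (w z : I) :
    (if z ∈ c.branch x then c.P w z else 0)
        + (if z = c.par x then if w = x then c.P w z else 0 else 0)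
      = (if w ∈ c.branch x then c.P w z else 0)
        + (if z = x then if w = c.par x then c.P w z else 0 else 0) := by
  by_cases hP : c.P w z = 0
  · simp [hP]
  have hlt := c.depth_par_lt hx
  have h1 : c.par x ≠ x := fun h => by rw [h] at hlt; omega
  have h2 : c.par (c.par x) ≠ x := fun h => by
    have := c.depth_par_le (c.par x)
    rw [h] at this; omega
  have h3 : c.par x ∉ c.branch x := fun h => by
    have := c.depth_le_of_mem_branch h; omega
  have h4 : x ∈ c.branch x := ⟨0, rfl⟩
  rcases c.P_support w z hP with rfl | rfl | rfl
  · by_cases hz : z = x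
    · subst hz; simp [h1.symm]
    · simp [hz]
  · by_cases hw : w = x
    · subst hw; simp [h3, h4, h1]
    · have h5 : ¬ (c.par w = x ∧ w = c.par x) := fun h => h2 (h.2 ▸ h.1)
      have h6 : w ∈ c.branch x ↔ c.par w ∈ c.branch x := by rw [c.mem_branch_iff]; simp [hw]
      simp only [h6, hw, if_false, ite_self, add_zero]
      rw [← ite_and, if_neg h5, add_zero]
  · by_cases hz : z = x
    · rw [hz]; simp [h3, h4, h1.symm]
    · have h5 : ¬ (z = c.par x ∧ c.par z = x) := fun h => h2 (h.1 ▸ h.2)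
      have h6 : z ∈ c.branch x ↔ c.par z ∈ c.branch x := by rw [c.mem_branch_iff]; simp [hz]
      simp only [h6, hz, if_false, add_zero]
      rw [← ite_and, if_neg h5, add_zero]

open Classical in
theorem tsum_branch_flux {x : I} (hx : x ≠ c.root) (w : I) :
    (∑' z, if z ∈ c.branch x then c.P w z else 0) + (if w = x then c.mu x else 0)
      = (if w ∈ c.branch x then 1 else 0) + (if w = c.par x then c.lamP x else 0) := by
  have h := tsum_congr (L := .unconditional I) (c.branch_flux hx w)
  rw [ENNReal.tsum_add, ENNReal.tsum_add, tsum_ite_eq, tsum_ite_eq] at h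
  convert h using 2
  · split_ifs with h' <;> simp [mu, h']
  · split_ifs <;> simp [c.P_row]
  · split_ifs with h' <;> simp [lamP, h']

/-- The mass that `π`, killed at `y`, still gives at time `t` to the branch of `x`. -/
def branchMass (x y : I) (t : ℕ) : ℝ≥0∞ :=
  ∑' z, (c.branch x).indicator c.invm z * c.survival y t z

theorem branchMass_zero {x y : I} (hy : y ∉ c.branch x) :
    c.branchMass x y 0 = c.piSet (c.branch x) := by
  rw [piSet, tsum_subtype, branchMass]
  refine tsum_congr fun z => ?_
  by_cases hz : z ∈ c.branch x
  · have : z ≠ y := ne_of_mem_of_not_mem hz hy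
    simp [survival, this]
  · simp [hz]

theorem branchMass_succ {x y : I} (hx : x ≠ c.root) (hy : y ∉ c.branch x) (t : ℕ) :
    c.branchMass x y (t + 1) + c.mu x * c.invm x * c.survival y t x
      = c.branchMass x y t + c.mu x * c.invm x * c.survival y t (c.par x) := by
  classical
  have h1 : c.branchMass x y (t + 1)
      = ∑' w, c.invm w * c.survival y t w * ∑' z, if z ∈ c.branch x then c.P w z else 0 := by
    simp_rw [← ENNReal.tsum_mul_left]
    rw [ENNReal.tsum_comm, branchMass]
    refine tsum_congr fun z => ?_
    by_cases hz : z ∈ c.branch x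
    · rw [c.survival_succ (ne_of_mem_of_not_mem hz hy), Set.indicator_of_mem hz, ← ENNReal.tsum_mul_left]
      refine tsum_congr fun w => ?_
      rw [if_pos hz, ← mul_assoc, c.invm_rev z w]
      ring
    · simp [hz]
  have h2 : c.mu x * c.invm x * c.survival y t x
      = ∑' w, c.invm w * c.survival y t w * if w = x then c.mu x else 0 := by
    simp_rw [mul_ite, mul_zero]
    rw [tsum_ite_eq]
    ring
  have h3 : c.mu x * c.invm x * c.survival y t (c.par x)
      = ∑' w, c.invm w * c.survival y t w * if w = c.par x then c.lamP x else 0 := by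
    simp_rw [mul_ite, mul_zero]
    rw [tsum_ite_eq, mul_comm (c.mu x), mu, c.invm_rev, lamP]
    ring
  rw [h1, h2, h3, branchMass, ← ENNReal.tsum_add, ← ENNReal.tsum_add]
  refine tsum_congr fun w => ?_
  rw [← mul_add, c.tsum_branch_flux hx, mul_add]
  congr 1
  by_cases hw : w ∈ c.branch x <;> simp [hw]

theorem branchMass_add_sum {x y : I} (hx : x ≠ c.root) (hy : y ∉ c.branch x) (N : ℕ) :
    c.branchMass x y N + c.mu x * c.invm x * ∑ t ∈ Finset.range N, c.survival y t x
      = c.piSet (c.branch x)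
        + c.mu x * c.invm x * ∑ t ∈ Finset.range N, c.survival y t (c.par x) := by
  induction N with
  | zero => simp [c.branchMass_zero hy]
  | succ N ih =>
    have h := c.branchMass_succ hx hy N
    rw [Finset.sum_range_succ, Finset.sum_range_succ, mul_add, mul_add, ← add_assoc (c.piSet _),
      ← ih, add_left_comm, h]
    ring

theorem tendsto_survival_of_mem_branch {x y : I} (hy : y ∉ c.branch x)
    (h : Tendsto (fun t => c.survival y t x) atTop (𝓝 0)) {z : I} (hz : z ∈ c.branch x)
    (hx : x ≠ c.root) : Tendsto (fun t => c.survival y t z) atTop (𝓝 0) := by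
  obtain ⟨n, hn⟩ := hz
  induction n generalizing z with
  | zero =>
    obtain rfl : z = x := hn
    exact h
  | succ n ih =>
    have hz : z ≠ c.root := fun h' => by
      have := c.depth_le_of_mem_branch (x := x) ⟨n + 1, hn⟩
      have := c.depth_par_lt hx
      rw [h', c.depth_root] at *
      omega
    have hpar : c.par z ≠ y := fun h' => hy (h' ▸ ⟨n, hn⟩)
    have hp := c.lam_pos z hz
    have hlim := (tendsto_add_atTop_iff_nat 1).2 (ih hn)
    have hdiv := ENNReal.Tendsto.const_mul (a := (c.P (c.par z) z)⁻¹) hlim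
      (Or.inr (ENNReal.inv_ne_top.2 hp))
    rw [mul_zero] at hdiv
    refine tendsto_of_tendsto_of_tendsto_of_le_of_le tendsto_const_nhds hdiv
      (fun _ => zero_le) fun t => ?_
    have hle : c.P (c.par z) z * c.survival y t z ≤ c.survival y (t + 1) (c.par z) := by
      rw [c.survival_succ hpar]
      exact ENNReal.le_tsum (f := fun w => c.P (c.par z) w * c.survival y t w) z
    calc c.survival y t z
        = (c.P (c.par z) z)⁻¹ * (c.P (c.par z) z * c.survival y t z) := by
          rw [← mul_assoc, ENNReal.inv_mul_cancel hp
            ((c.P_le_one _ _).trans_lt ENNReal.one_lt_top).ne, one_mul]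
      _ ≤ _ := mul_le_mul_right hle _

theorem ET_eq_add_ET_par [Countable I] {x y : I} (hx : x ≠ c.root) (hy : y ∉ c.branch x)
    (hfin : c.ET (c.par x) y ≠ ∞) :
    c.ET x y = c.piSet (c.branch x) / (c.mu x * c.invm x) + c.ET (c.par x) y := by
  have hπ : c.invm x ≠ ∞ := ENNReal.ne_top_of_tsum_ne_top (c.invm_sum ▸ ENNReal.one_ne_top) x
  have hB : c.piSet (c.branch x) ≠ ∞ := ((c.piSet_le_one _).trans_lt ENNReal.one_lt_top).ne
  have hμ : c.mu x ≠ ∞ := ((c.P_le_one _ _).trans_lt ENNReal.one_lt_top).ne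
  set q := c.mu x * c.invm x
  have hq0 : q ≠ 0 := mul_ne_zero (c.mu_pos x hx) (c.invm_pos x)
  have hqt : q ≠ ∞ := ENNReal.mul_ne_top hμ hπ
  have hsum : ∀ z, Tendsto (fun N => q * ∑ t ∈ Finset.range N, c.survival y t z) atTop
      (𝓝 (q * c.ET z y)) := fun z => by
    rw [c.ET_eq_tsum_survival]
    exact ENNReal.Tendsto.const_mul (ENNReal.tendsto_nat_tsum _) (Or.inr hqt)
  have hright := (tendsto_const_nhds (x := c.piSet (c.branch x))).add (hsum (c.par x))
  have hle : q * c.ET x y ≤ c.piSet (c.branch x) + q * c.ET (c.par x) y :=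
    le_of_tendsto_of_tendsto' (hsum x) hright fun N =>
      (c.branchMass_add_sum hx hy N) ▸ le_add_self
  have hETx : c.ET x y ≠ ∞ := fun h => by
    rw [h, ENNReal.mul_top hq0] at hle
    exact ENNReal.add_ne_top.2 ⟨hB, ENNReal.mul_ne_top hqt hfin⟩ (top_le_iff.1 hle)
  have hlim : Tendsto (fun t => c.survival y t x) atTop (𝓝 0) := by
    rw [c.ET_eq_tsum_survival] at hETx
    exact ENNReal.tendsto_atTop_zero_of_tsum_ne_top hETx
  have hmass : Tendsto (c.branchMass x y) atTop (𝓝 0) := by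
    refine ENNReal.tendsto_tsum_mul_zero ?_ (c.survival_le_one y) fun z hz =>
      c.tendsto_survival_of_mem_branch hy hlim (Set.mem_of_indicator_ne_zero hz) hx
    rwa [← tsum_subtype]
  have heq : 0 + q * c.ET x y = c.piSet (c.branch x) + q * c.ET (c.par x) y :=
    tendsto_nhds_unique ((hmass.add (hsum x)).congr (c.branchMass_add_sum hx hy)) hright
  rw [zero_add] at heq
  rw [← ENNReal.mul_right_inj hq0 hqt, heq, mul_add, ENNReal.mul_div_cancel hq0 hqt]

theorem ET_self [Countable I] (y : I) : c.ET y y = 0 := by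
  simp [c.ET_eq_tsum_survival, c.survival_self]

end Branch

end TreeChain

/-- **Proposition (mean hitting times), child → ancestor**: for `0 ≤ j < n ≤ d(a)`,
`E[T^{a_j}_{a_n}] = Σ_{k=j}^{n−1} π(B_{a_k})/(μ_{a_k} π(a_k))`, where `a_i = p^i(a)`. -/
theorem ET_iterate_up {I : Type*} [MeasurableSpace I] [Countable I]
    (c : TreeChain I) (a : I) (ha : a ≠ c.root)
    (j n : ℕ) (hjn : j < n) (hn : n ≤ c.depth a) :
    c.ET (c.par^[j] a) (c.par^[n] a)
      = ∑ k ∈ Finset.Ico j n,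
          c.piSet (c.branch (c.par^[k] a)) / (c.mu (c.par^[k] a) * c.invm (c.par^[k] a)) := by
  suffices h : c.ET (c.par^[j] a) (c.par^[n] a) ≠ ∞ ∧ c.ET (c.par^[j] a) (c.par^[n] a)
      = ∑ k ∈ Finset.Ico j n,
          c.piSet (c.branch (c.par^[k] a)) / (c.mu (c.par^[k] a) * c.invm (c.par^[k] a)) from h.2
  have hle := hjn.le
  clear hjn
  induction hle using Nat.decreasingInduction with
  | self => simp [c.ET_self]
  | of_succ k hk ih =>
    have hdk := c.depth_iterate_par a (k := k) (by omega)
    have hdn := c.depth_iterate_par a hn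
    have hx : c.par^[k] a ≠ c.root := fun h => by
      rw [h, c.depth_root] at hdk; omega
    have hy : c.par^[n] a ∉ c.branch (c.par^[k] a) := fun h => by
      have := c.depth_le_of_mem_branch h; omega
    obtain ⟨hfin, hih⟩ := ih
    rw [Function.iterate_succ_apply'] at hfin hih
    have hstep := c.ET_eq_add_ET_par hx hy hfin
    have hterm : c.piSet (c.branch (c.par^[k] a)) / (c.mu (c.par^[k] a) * c.invm (c.par^[k] a))
        ≠ ∞ := ENNReal.div_ne_top ((c.piSet_le_one _).trans_lt ENNReal.one_lt_top).ne
          (mul_ne_zero (c.mu_pos _ hx) (c.invm_pos _))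
    refine ⟨hstep ▸ ENNReal.add_ne_top.2 ⟨hterm, hfin⟩, ?_⟩
    rw [hstep, hih, Finset.sum_eq_sum_Ico_succ_bot hk]
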